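/- arXiv:1409.0564 — 3 statements merged into one kernel-verified Lean document; each statement's English description precedes it below -/
import Mathlib

section
/- Let 0 < p ≤ 1, 0 < q ≤ 1, and 0 < s < 1/2. Then for every n, the trace function Φ_{p,q,s}(A,B) = Tr[(A^{q/2} B^p A^{q/2})^s] is jointly concave on pairs of n×n positive definite complex matrices. -/
open Matrix
open scoped ComplexOrder

/-- Real power of a matrix, defined via the spectral decomposition when the matrix is
Hermitian (junk value `0` otherwise). For a positive (semi-)definite matrix this is the
usual real power given by the spectral functional calculus (with `0 ^ r = 0`). -/
noncomputable def mpow {n : ℕ} (A : Matrix (Fin n) (Fin n) ℂ) (r : ℝ) :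
    Matrix (Fin n) (Fin n) ℂ :=
  if h : A.IsHermitian then
    (h.eigenvectorUnitary : Matrix (Fin n) (Fin n) ℂ) *
      Matrix.diagonal (fun i => ((h.eigenvalues i ^ r : ℝ) : ℂ)) *
      (star h.eigenvectorUnitary : Matrix (Fin n) (Fin n) ℂ)
  else 0

/-- `Ψ_{K,p,q,s}(A,B) = Tr[(A^{q/2} K* B^p K A^{q/2})^s]`. -/
noncomputable def Psi {n : ℕ} (K : Matrix (Fin n) (Fin n) ℂ) (p q s : ℝ)
    (A B : Matrix (Fin n) (Fin n) ℂ) : ℝ :=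
  (Matrix.trace (mpow (mpow A (q / 2) * Kᴴ * mpow B p * K * mpow A (q / 2)) s)).re

/-- `Φ_{p,q,s}(A,B) = Tr[(A^{q/2} B^p A^{q/2})^s]`. -/
noncomputable def Phi {n : ℕ} (p q s : ℝ) (A B : Matrix (Fin n) (Fin n) ℂ) : ℝ :=
  (Matrix.trace (mpow (mpow A (q / 2) * mpow B p * mpow A (q / 2)) s)).re

/-- Joint concavity of a real-valued function of two positive definite matrices. -/
def JointlyConcave {n : ℕ}
    (f : Matrix (Fin n) (Fin n) ℂ → Matrix (Fin n) (Fin n) ℂ → ℝ) : Prop :=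
  ∀ A₁ A₂ B₁ B₂ : Matrix (Fin n) (Fin n) ℂ,
    A₁.PosDef → A₂.PosDef → B₁.PosDef → B₂.PosDef →
    ∀ t : ℝ, 0 ≤ t → t ≤ 1 →
      t * f A₁ B₁ + (1 - t) * f A₂ B₂ ≤
        f (t • A₁ + (1 - t) • A₂) (t • B₁ + (1 - t) • B₂)

section TraceConcavity

open scoped MatrixOrder Matrix.Norms.L2Operator

section Spectral

variable {n : ℕ} {A B : Matrix (Fin n) (Fin n) ℂ}

lemma mpow_eq_cfc (hA : A.IsHermitian) (r : ℝ) : mpow A r = cfc (fun x : ℝ => x ^ r) A := by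
  rw [hA.cfc_eq, IsHermitian.cfc, Unitary.conjStarAlgAut_apply, mpow, dif_pos hA]
  rfl

lemma trace_cfc_eq_sum (hA : A.IsHermitian) (f : ℝ → ℝ) :
    (cfc f A).trace = ∑ i, (f (hA.eigenvalues i) : ℂ) := by
  rw [hA.cfc_eq, IsHermitian.cfc, Unitary.conjStarAlgAut_apply, trace_mul_comm, ← mul_assoc]
  simp [trace_diagonal]

lemma det_cfc_eq_prod (hA : A.IsHermitian) (f : ℝ → ℝ) :
    (cfc f A).det = ∏ i, (f (hA.eigenvalues i) : ℂ) := by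
  rw [hA.cfc_eq, IsHermitian.cfc, Unitary.conjStarAlgAut_apply, det_mul_comm, ← mul_assoc]
  simp [det_diagonal]

lemma posDef_cfc (hA : A.IsHermitian) {f : ℝ → ℝ} (hf : ∀ i, 0 < f (hA.eigenvalues i)) :
    (cfc f A).PosDef := by
  rw [hA.cfc_eq, IsHermitian.cfc, Unitary.conjStarAlgAut_apply]
  refine (IsUnit.posDef_star_right_conjugate_iff (Unitary.isUnit_coe)).2 ?_
  exact PosDef.diagonal fun i => by simpa using hf i

lemma continuousOn_spectrum (A : Matrix (Fin n) (Fin n) ℂ) (f : ℝ → ℝ) :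
    ContinuousOn f (spectrum ℝ A) :=
  (Matrix.finite_real_spectrum).continuousOn f

lemma posDef_mpow (hA : A.PosDef) (r : ℝ) : (mpow A r).PosDef := by
  rw [mpow_eq_cfc hA.isHermitian]
  exact posDef_cfc hA.isHermitian fun i => Real.rpow_pos_of_pos (hA.eigenvalues_pos i) r

lemma mpow_half_mul_self (hA : A.PosDef) (r : ℝ) :
    mpow A (r / 2) * mpow A (r / 2) = mpow A r := by
  simp only [mpow_eq_cfc hA.isHermitian]
  rw [← cfc_mul _ _ A (continuousOn_spectrum A _) (continuousOn_spectrum A _)]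
  refine cfc_congr fun x hx => ?_
  have hx' : 0 < x := by
    rw [hA.isHermitian.spectrum_real_eq_range_eigenvalues] at hx
    obtain ⟨i, rfl⟩ := hx
    exact hA.eigenvalues_pos i
  simp only [← Real.rpow_add hx', add_halves]

lemma mpow_one (hA : A.IsHermitian) : mpow A 1 = A := by
  rw [mpow_eq_cfc hA]
  simp only [Real.rpow_one]
  exact cfc_id' ℝ A hA

lemma mpow_concave {r t : ℝ} (hr₀ : 0 ≤ r) (hr₁ : r ≤ 1) (hA : A.PosDef) (hB : B.PosDef)
    (ht₀ : 0 ≤ t) (ht₁ : t ≤ 1) :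
    t • mpow A r + (1 - t) • mpow B r ≤ mpow (t • A + (1 - t) • B) r := by
  have hA' : 0 ≤ A := hA.posSemidef.nonneg
  have hB' : 0 ≤ B := hB.posSemidef.nonneg
  have h := (CFC.concaveOn_rpow (A := Matrix (Fin n) (Fin n) ℂ) ⟨hr₀, hr₁⟩)
  have hC : 0 ≤ t • A + (1 - t) • B := h.1 hA' hB' ht₀ (sub_nonneg.2 ht₁) (by ring)
  have key : ∀ C : Matrix (Fin n) (Fin n) ℂ, 0 ≤ C → mpow C r = C ^ r := fun C hC => by
    rw [mpow_eq_cfc (nonneg_iff_posSemidef.1 hC).isHermitian, CFC.rpow_eq_cfc_real hC]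
  rw [key _ hA', key _ hB', key _ hC]
  exact h.2 hA' hB' ht₀ (sub_nonneg.2 ht₁) (by ring)

end Spectral

section LogDet

variable {n : ℕ} {A B : Matrix (Fin n) (Fin n) ℂ}

lemma log_norm_det_eq_trace_log (hA : A.PosDef) :
    Real.log ‖A.det‖ = (CFC.log A).trace.re := by
  rw [CFC.log, trace_cfc_eq_sum hA.isHermitian, hA.isHermitian.det_eq_prod_eigenvalues, norm_prod,
    Real.log_prod fun i _ => by simpa using (hA.eigenvalues_pos i).ne']
  simp

lemma trace_re_mono (h : A ≤ B) : A.trace.re ≤ B.trace.re := by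
  have := (Complex.le_def.1 (PosSemidef.trace_nonneg (le_iff.1 h))).1
  simpa [trace_sub] using this

lemma log_norm_det_mono (hA : A.PosDef) (h : A ≤ B) :
    Real.log ‖A.det‖ ≤ Real.log ‖B.det‖ := by
  have hA' := isStrictlyPositive_iff_posDef.2 hA
  rw [log_norm_det_eq_trace_log hA,
    log_norm_det_eq_trace_log (isStrictlyPositive_iff_posDef.1 (hA'.of_le h))]
  exact trace_re_mono (CFC.log_le_log h hA')

lemma posDef_convex_comb (hA : A.PosDef) (hB : B.PosDef) {t : ℝ} (ht₀ : 0 ≤ t) (ht₁ : t ≤ 1) :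
    (t • A + (1 - t) • B).PosDef :=
  isStrictlyPositive_iff_posDef.1 <| (CFC.concaveOn_log (A := Matrix (Fin n) (Fin n) ℂ)).1
    (isStrictlyPositive_iff_posDef.2 hA) (isStrictlyPositive_iff_posDef.2 hB) ht₀
    (sub_nonneg.2 ht₁) (by ring)

lemma log_norm_det_concave (hA : A.PosDef) (hB : B.PosDef) {t : ℝ}
    (ht₀ : 0 ≤ t) (ht₁ : t ≤ 1) :
    t * Real.log ‖A.det‖ + (1 - t) * Real.log ‖B.det‖ ≤
      Real.log ‖(t • A + (1 - t) • B).det‖ := by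
  have h := CFC.concaveOn_log (A := Matrix (Fin n) (Fin n) ℂ)
  have hA' := isStrictlyPositive_iff_posDef.2 hA
  have hB' := isStrictlyPositive_iff_posDef.2 hB
  rw [log_norm_det_eq_trace_log hA, log_norm_det_eq_trace_log hB,
    log_norm_det_eq_trace_log (posDef_convex_comb hA hB ht₀ ht₁)]
  have := trace_re_mono (h.2 hA' hB' ht₀ (sub_nonneg.2 ht₁) (by ring))
  simpa [trace_add, trace_smul] using this

lemma log_norm_det_one_add_le {N S : Matrix (Fin n) (Fin n) ℂ} (hN : N.PosDef) (hS : S.PosDef) :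
    2 * Real.log ‖(1 + S).det‖ ≤
      Real.log ‖(1 + N).det‖ + Real.log ‖(1 + S * N⁻¹ * S).det‖ := by
  have h1N : (1 + N).PosDef := PosDef.one.add hN
  have h1S : (1 + S).PosDef := PosDef.one.add hS
  have := hN.isUnit.invertible
  have := h1N.isUnit.invertible
  have b₁ : (fromBlocks N S Sᴴ (S * N⁻¹ * S)).PosSemidef :=
    (hN.fromBlocks₁₁ _ _).2 (by simp [hS.isHermitian.eq, PosSemidef.zero])
  have : Invertible (1 : Matrix (Fin n) (Fin n) ℂ) := invertibleOne
  have b₂ : (fromBlocks 1 1 (1 : Matrix (Fin n) (Fin n) ℂ)ᴴ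
      (1 : Matrix (Fin n) (Fin n) ℂ)).PosSemidef :=
    (PosDef.one.fromBlocks₁₁ _ _).2 (by simp [PosSemidef.zero])
  have b₃ := b₂.add b₁
  rw [fromBlocks_add, ← conjTranspose_add, h1N.fromBlocks₁₁, h1S.isHermitian.eq] at b₃
  have hP : ((1 + S) * (1 + N)⁻¹ * (1 + S)).PosDef := by
    have := (IsUnit.posDef_star_left_conjugate_iff h1S.isUnit).2 h1N.inv
    rwa [star_eq_conjTranspose, h1S.isHermitian.eq] at this
  have h := log_norm_det_mono hP (le_iff.2 b₃)
  have hne : ∀ {C : Matrix (Fin n) (Fin n) ℂ}, C.PosDef → ‖C.det‖ ≠ 0 := fun hC =>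
    norm_ne_zero_iff.2 ((isUnit_iff_isUnit_det _).1 hC.isUnit).ne_zero
  rw [det_mul, det_mul, norm_mul, norm_mul,
    Real.log_mul (mul_ne_zero (hne h1S) (hne h1N.inv)) (hne h1S),
    Real.log_mul (hne h1S) (hne h1N.inv), det_nonsing_inv, Ring.inverse_eq_inv', norm_inv,
    Real.log_inv] at h
  linarith

end LogDet

section FidelityLogDet

variable {n : ℕ}

lemma posDef_mul_mul {R P : Matrix (Fin n) (Fin n) ℂ} (hR : R.PosDef) (hP : P.PosDef) :
    (R * P * R).PosDef := by
  have := (IsUnit.posDef_star_left_conjugate_iff hR.isUnit).2 hP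
  rwa [star_eq_conjTranspose, hR.isHermitian.eq] at this

lemma log_norm_det_one_add_conj_concave {R P₀ P₁ P₂ : Matrix (Fin n) (Fin n) ℂ}
    (hR : R.PosDef) (h₁ : P₁.PosDef) (h₂ : P₂.PosDef) {t u : ℝ} (ht₀ : 0 ≤ t) (ht₁ : t ≤ 1)
    (hu : 0 < u) (h : t • P₁ + (1 - t) • P₂ ≤ P₀) :
    t * Real.log ‖(1 + u • (R * P₁ * R)).det‖ + (1 - t) * Real.log ‖(1 + u • (R * P₂ * R)).det‖ ≤
      Real.log ‖(1 + u • (R * P₀ * R)).det‖ := by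
  have pd : ∀ {P : Matrix (Fin n) (Fin n) ℂ}, P.PosDef → (1 + u • (R * P * R)).PosDef :=
    fun hP => PosDef.one.add ((posDef_mul_mul hR hP).smul hu)
  refine (log_norm_det_concave (pd h₁) (pd h₂) ht₀ ht₁).trans
    (log_norm_det_mono (posDef_convex_comb (pd h₁) (pd h₂) ht₀ ht₁) ?_)
  rw [le_iff]
  have := ((le_iff.1 h).mul_mul_conjTranspose_same R).smul hu.le
  rw [hR.isHermitian.eq] at this
  convert this using 1
  simp only [mul_sub, sub_mul, mul_add, add_mul, smul_add, smul_sub, mul_smul_comm,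
    smul_mul_assoc, smul_smul]
  module

lemma det_one_add_smul_conj {X R : Matrix (Fin n) (Fin n) ℂ} (u : ℝ) :
    (1 + u • (R * (X * X) * R)).det = (1 + u • (X * (R * R) * X)).det := by
  have := det_one_add_mul_comm (u • (R * X)) (X * R)
  simpa only [smul_mul_assoc, mul_smul_comm, mul_assoc] using this

lemma det_one_add_smul_conj_inv {X Q S R : Matrix (Fin n) (Fin n) ℂ} (hX : X.PosDef)
    (hS : S * S = X * Q * X) (u : ℝ) :
    (1 + u • (R⁻¹ * Q * R⁻¹)).det = (1 + u • (S * (X * (R * R) * X)⁻¹ * S)).det := by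
  have hXd := (isUnit_iff_isUnit_det X).1 hX.isUnit
  have e₁ := det_one_add_mul_comm (u • (S * (X * (R * R) * X)⁻¹)) S
  have e₂ := det_one_add_mul_comm (u • (X * Q * R⁻¹)) (R⁻¹ * X⁻¹)
  have e₃ : S * (u • (S * (X * (R * R) * X)⁻¹)) = u • (X * Q * R⁻¹) * (R⁻¹ * X⁻¹) := by
    rw [mul_smul_comm, ← mul_assoc, hS, Matrix.mul_inv_rev, Matrix.mul_inv_rev,
      Matrix.mul_inv_rev, smul_mul_assoc]
    simp only [mul_assoc]
    rw [mul_nonsing_inv_cancel_left _ _ hXd]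
  have e₄ : R⁻¹ * X⁻¹ * (u • (X * Q * R⁻¹)) = u • (R⁻¹ * Q * R⁻¹) := by
    rw [mul_smul_comm]
    simp only [mul_assoc]
    rw [nonsing_inv_mul_cancel_left _ _ hXd]
  rw [e₃, e₂, e₄, smul_mul_assoc] at e₁
  exact e₁.symm

lemma two_mul_log_norm_det_le {X Q S R : Matrix (Fin n) (Fin n) ℂ} (hX : X.PosDef)
    (hSp : S.PosDef) (hS : S * S = X * Q * X) (hR : R.PosDef) {u : ℝ} (hu : 0 < u) :
    2 * Real.log ‖(1 + u • S).det‖ ≤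
      Real.log ‖(1 + u • (R * (X * X) * R)).det‖ +
        Real.log ‖(1 + u • (R⁻¹ * Q * R⁻¹)).det‖ := by
  have hN : (X * (R * R) * X).PosDef :=
    posDef_mul_mul hX (by simpa using posDef_mul_mul hR PosDef.one)
  rw [det_one_add_smul_conj, det_one_add_smul_conj_inv hX hS]
  have h := log_norm_det_one_add_le (hN.smul hu) (hSp.smul hu)
  have e : (u • S) * (u • (X * (R * R) * X))⁻¹ * (u • S) =
      u • (S * (X * (R * R) * X)⁻¹ * S) := by
    have hinv : (u • (X * (R * R) * X))⁻¹ = u⁻¹ • (X * (R * R) * X)⁻¹ := by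
      refine inv_eq_right_inv ?_
      rw [smul_mul_smul_comm, mul_inv_cancel₀ hu.ne', one_smul,
        mul_nonsing_inv _ ((isUnit_iff_isUnit_det _).1 hN.isUnit)]
    rw [hinv, smul_mul_smul_comm, mul_inv_cancel₀ hu.ne', one_smul, mul_smul_comm]
  rwa [e] at h

/-- Equality in `two_mul_log_norm_det_le` is attained when `R ^ 2 = X⁻¹ S X⁻¹`. -/
lemma exists_two_mul_log_norm_det_eq {X Q S : Matrix (Fin n) (Fin n) ℂ} (hX : X.PosDef)
    (hSp : S.PosDef) (hS : S * S = X * Q * X) (u : ℝ) :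
    ∃ R : Matrix (Fin n) (Fin n) ℂ, R.PosDef ∧
      Real.log ‖(1 + u • (R * (X * X) * R)).det‖ + Real.log ‖(1 + u • (R⁻¹ * Q * R⁻¹)).det‖ =
        2 * Real.log ‖(1 + u • S).det‖ := by
  have hM : (X⁻¹ * S * X⁻¹).PosDef := posDef_mul_mul hX.inv hSp
  have hXd := (isUnit_iff_isUnit_det X).1 hX.isUnit
  refine ⟨_, posDef_mpow hM (1 / 2), ?_⟩
  rw [det_one_add_smul_conj, det_one_add_smul_conj_inv hX hS, mpow_half_mul_self hM,
    mpow_one hM.isHermitian]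
  have e : X * (X⁻¹ * S * X⁻¹) * X = S := by
    simp only [mul_assoc]
    rw [mul_nonsing_inv_cancel_left _ _ hXd, nonsing_inv_mul _ hXd, mul_one]
  rw [e, mul_nonsing_inv _ ((isUnit_iff_isUnit_det _).1 hSp.isUnit), one_mul, two_mul]

/-- With `S = (X Q X) ^ (1 / 2)`, the function `log det (1 + u S)` is jointly concave and monotone
in `(X ^ 2, Q)`. -/
lemma log_norm_det_one_add_jointly_concave
    {X₀ X₁ X₂ Q₀ Q₁ Q₂ S₀ S₁ S₂ : Matrix (Fin n) (Fin n) ℂ}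
    (hX₀ : X₀.PosDef) (hX₁ : X₁.PosDef) (hX₂ : X₂.PosDef)
    (hQ₁ : Q₁.PosDef) (hQ₂ : Q₂.PosDef)
    (hS₀ : S₀.PosDef) (hS₁ : S₁.PosDef) (hS₂ : S₂.PosDef)
    (e₀ : S₀ * S₀ = X₀ * Q₀ * X₀) (e₁ : S₁ * S₁ = X₁ * Q₁ * X₁) (e₂ : S₂ * S₂ = X₂ * Q₂ * X₂)
    {t u : ℝ} (ht₀ : 0 ≤ t) (ht₁ : t ≤ 1) (hu : 0 < u)
    (hX : t • (X₁ * X₁) + (1 - t) • (X₂ * X₂) ≤ X₀ * X₀)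
    (hQ : t • Q₁ + (1 - t) • Q₂ ≤ Q₀) :
    t * Real.log ‖(1 + u • S₁).det‖ + (1 - t) * Real.log ‖(1 + u • S₂).det‖ ≤
      Real.log ‖(1 + u • S₀).det‖ := by
  obtain ⟨R, hR, h₀⟩ := exists_two_mul_log_norm_det_eq hX₀ hS₀ e₀ u
  have sq : ∀ {X : Matrix (Fin n) (Fin n) ℂ}, X.PosDef → (X * X).PosDef := fun h => by
    simpa using posDef_mul_mul h PosDef.one
  have k₁ := mul_le_mul_of_nonneg_left (two_mul_log_norm_det_le hX₁ hS₁ e₁ hR hu) ht₀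
  have k₂ := mul_le_mul_of_nonneg_left (two_mul_log_norm_det_le hX₂ hS₂ e₂ hR hu)
    (sub_nonneg.2 ht₁)
  have c₁ := log_norm_det_one_add_conj_concave hR (sq hX₁) (sq hX₂) ht₀ ht₁ hu hX
  have c₂ := log_norm_det_one_add_conj_concave hR.inv hQ₁ hQ₂ ht₀ ht₁ hu hQ
  linarith

end FidelityLogDet

section PowerIntegral

open MeasureTheory Set

lemma integrableOn_log_one_add_mul_rpow {r : ℝ} (hr₀ : 0 < r) (hr₁ : r < 1) :
    IntegrableOn (fun u : ℝ => Real.log (1 + u) * u ^ (-1 - r)) (Ioi 0) := by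
  have hm : Measurable (fun u : ℝ => Real.log (1 + u) * u ^ (-1 - r)) := by fun_prop
  rw [← Ioc_union_Ioi_eq_Ioi zero_le_one]
  refine IntegrableOn.union ?_ ?_
  · have hi : IntegrableOn (fun u : ℝ => u ^ (-r)) (Ioc 0 1) :=
      (intervalIntegrable_iff_integrableOn_Ioc_of_le zero_le_one).1
        (intervalIntegral.intervalIntegrable_rpow' (by linarith))
    refine hi.mono' hm.aestronglyMeasurable ?_
    filter_upwards [ae_restrict_mem measurableSet_Ioc] with u hu
    have hlog : Real.log (1 + u) ≤ u := by
      linarith [Real.log_le_sub_one_of_pos (by linarith [hu.1] : 0 < 1 + u)]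
    have hpow := Real.rpow_pos_of_pos hu.1 (-1 - r)
    rw [Real.norm_of_nonneg (mul_nonneg (Real.log_nonneg (by linarith [hu.1])) hpow.le)]
    calc _ ≤ u * u ^ (-1 - r) := by gcongr
      _ = u ^ (-r) := by
        rw [← Real.rpow_one_add' hu.1.le (by linarith)]; congr 1; ring
  · have hi : IntegrableOn (fun u : ℝ => (2 ^ (r / 2) / (r / 2)) * u ^ (-1 - r / 2)) (Ioi 1) :=
      (integrableOn_Ioi_rpow_of_lt (by linarith) zero_lt_one).const_mul _
    refine hi.mono' hm.aestronglyMeasurable ?_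
    filter_upwards [ae_restrict_mem measurableSet_Ioi] with u (hu : 1 < u)
    have hu₀ : 0 < u := zero_lt_one.trans hu
    have hlog : Real.log (1 + u) ≤ (2 * u) ^ (r / 2) / (r / 2) :=
      (Real.log_le_log (by linarith) (by linarith)).trans
        (Real.log_le_rpow_div (by linarith) (by linarith))
    have hpow := Real.rpow_pos_of_pos hu₀ (-1 - r)
    rw [Real.norm_of_nonneg (mul_nonneg (Real.log_nonneg (by linarith)) hpow.le)]
    calc _ ≤ (2 * u) ^ (r / 2) / (r / 2) * u ^ (-1 - r) := by gcongr
      _ = (2 ^ (r / 2) / (r / 2)) * (u ^ (r / 2) * u ^ (-1 - r)) := by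
        rw [Real.mul_rpow zero_le_two hu₀.le]; ring
      _ = _ := by rw [← Real.rpow_add hu₀]; ring_nf

lemma integral_log_one_add_mul_rpow_pos {r : ℝ} (hr₀ : 0 < r) (hr₁ : r < 1) :
    0 < ∫ u in Ioi (0 : ℝ), Real.log (1 + u) * u ^ (-1 - r) := by
  have hpos : ∀ u ∈ Ioi (0 : ℝ), 0 < Real.log (1 + u) * u ^ (-1 - r) := fun u (hu : 0 < u) =>
    mul_pos (Real.log_pos (by linarith)) (Real.rpow_pos_of_pos hu _)
  rw [setIntegral_pos_iff_support_of_nonneg_ae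
    ((ae_restrict_mem measurableSet_Ioi).mono fun u hu => (hpos u hu).le)
    (integrableOn_log_one_add_mul_rpow hr₀ hr₁),
    inter_eq_right.2 fun u hu => Function.mem_support.2 (hpos u hu).ne']
  simp

lemma log_one_add_mul_eq_scaled {r x u : ℝ} (hx : 0 < x) (hu : 0 < u) :
    Real.log (1 + u * x) * u ^ (-1 - r) =
      x ^ (1 + r) * (Real.log (1 + u * x) * (u * x) ^ (-1 - r)) := by
  rw [Real.mul_rpow hu.le hx.le, show (-1 - r) = -(1 + r) by ring, Real.rpow_neg hx.le]
  field_simp [(Real.rpow_pos_of_pos hx (1 + r)).ne']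

lemma integrableOn_log_one_add_smul_mul_rpow {r x : ℝ} (hr₀ : 0 < r) (hr₁ : r < 1)
    (hx : 0 < x) :
    IntegrableOn (fun u : ℝ => Real.log (1 + u * x) * u ^ (-1 - r)) (Ioi 0) := by
  have h := (integrableOn_Ioi_comp_mul_right_iff
    (fun u : ℝ => Real.log (1 + u) * u ^ (-1 - r)) 0 hx).2
      (by simpa using integrableOn_log_one_add_mul_rpow hr₀ hr₁)
  exact IntegrableOn.congr_fun (h.const_mul (x ^ (1 + r)))
    (fun u hu => (log_one_add_mul_eq_scaled hx hu).symm) measurableSet_Ioi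

lemma integral_log_one_add_smul_mul_rpow {r x : ℝ} (hx : 0 < x) :
    ∫ u in Ioi (0 : ℝ), Real.log (1 + u * x) * u ^ (-1 - r) =
      (∫ u in Ioi (0 : ℝ), Real.log (1 + u) * u ^ (-1 - r)) * x ^ r := by
  rw [setIntegral_congr_fun measurableSet_Ioi fun u hu => log_one_add_mul_eq_scaled hx hu,
    integral_const_mul,
    integral_comp_mul_right_Ioi (fun u : ℝ => Real.log (1 + u) * u ^ (-1 - r)) 0 hx, zero_mul,
    Real.rpow_add hx, Real.rpow_one, smul_eq_mul]
  field_simp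

end PowerIntegral

section Trace

variable {n : ℕ} {T : Matrix (Fin n) (Fin n) ℂ}

lemma trace_mpow_re (hT : T.IsHermitian) (s : ℝ) :
    (mpow T s).trace.re = ∑ i, hT.eigenvalues i ^ s := by
  rw [mpow_eq_cfc hT, trace_cfc_eq_sum hT]
  simp

lemma log_norm_det_one_add_smul_mpow_half (hT : T.PosDef) {u : ℝ} (hu : 0 < u) :
    Real.log ‖(1 + u • mpow T (1 / 2)).det‖ =
      ∑ i, Real.log (1 + u * hT.isHermitian.eigenvalues i ^ (1 / 2 : ℝ)) := by
  have hpos : ∀ i, 0 < 1 + u * hT.isHermitian.eigenvalues i ^ (1 / 2 : ℝ) := fun i => by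
    have := Real.rpow_pos_of_pos (hT.eigenvalues_pos i) (1 / 2)
    positivity
  have e : 1 + u • mpow T (1 / 2) = cfc (fun x : ℝ => 1 + u * x ^ (1 / 2 : ℝ)) T := by
    have e₁ := cfc_const_add 1 (fun x : ℝ => u * x ^ (1 / 2 : ℝ)) T
      (continuousOn_spectrum T _) hT.isHermitian
    have e₂ := cfc_const_mul u (fun x : ℝ => x ^ (1 / 2 : ℝ)) T (continuousOn_spectrum T _)
    rw [e₂, map_one] at e₁
    rw [mpow_eq_cfc hT.isHermitian]
    exact e₁.symm
  rw [e, det_cfc_eq_prod hT.isHermitian, norm_prod,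
    Real.log_prod fun i _ => by
      rw [norm_ne_zero_iff]; exact mod_cast (hpos i).ne']
  refine Finset.sum_congr rfl fun i _ => ?_
  rw [Complex.norm_real, Real.norm_of_nonneg (hpos i).le]

open MeasureTheory Set

lemma log_one_add_trace_integral (hT : T.PosDef) {s : ℝ} (hs₀ : 0 < s) (hs₁ : s < 1 / 2) :
    IntegrableOn (fun u : ℝ => Real.log ‖(1 + u • mpow T (1 / 2)).det‖ * u ^ (-1 - 2 * s))
      (Ioi 0) ∧
    ∫ u in Ioi (0 : ℝ), Real.log ‖(1 + u • mpow T (1 / 2)).det‖ * u ^ (-1 - 2 * s) =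
      (∫ u in Ioi (0 : ℝ), Real.log (1 + u) * u ^ (-1 - 2 * s)) * (mpow T s).trace.re := by
  have hx : ∀ i, 0 < hT.isHermitian.eigenvalues i ^ (1 / 2 : ℝ) := fun i =>
    Real.rpow_pos_of_pos (hT.eigenvalues_pos i) _
  have heq : EqOn (fun u : ℝ => ∑ i,
      Real.log (1 + u * hT.isHermitian.eigenvalues i ^ (1 / 2 : ℝ)) * u ^ (-1 - 2 * s))
      (fun u : ℝ => Real.log ‖(1 + u • mpow T (1 / 2)).det‖ * u ^ (-1 - 2 * s)) (Ioi 0) :=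
    fun u hu => by
      simp only [log_norm_det_one_add_smul_mpow_half hT hu, Finset.sum_mul]
  have hint := fun i => integrableOn_log_one_add_smul_mul_rpow (r := 2 * s) (by linarith)
    (by linarith) (hx i)
  refine ⟨IntegrableOn.congr_fun (integrable_finsetSum _ fun i _ => hint i) heq
    measurableSet_Ioi, ?_⟩
  rw [← setIntegral_congr_fun measurableSet_Ioi heq, integral_finsetSum _ fun i _ => hint i,
    trace_mpow_re hT.isHermitian, Finset.mul_sum]
  refine Finset.sum_congr rfl fun i _ => ?_
  rw [integral_log_one_add_smul_mul_rpow (hx i), ← Real.rpow_mul (hT.eigenvalues_pos i).le]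
  ring_nf

end Trace

open MeasureTheory Set in
lemma phi_concave_of_posDef {p q s : ℝ} (hp₁ : 0 < p) (hp₂ : p ≤ 1)
    (hq₁ : 0 < q) (hq₂ : q ≤ 1) (hs₁ : 0 < s) (hs₂ : s < 1 / 2) {n : ℕ}
    {A₁ A₂ B₁ B₂ : Matrix (Fin n) (Fin n) ℂ}
    (hA₁ : A₁.PosDef) (hA₂ : A₂.PosDef) (hB₁ : B₁.PosDef) (hB₂ : B₂.PosDef)
    {t : ℝ} (ht₀ : 0 ≤ t) (ht₁ : t ≤ 1) :
    t * Phi p q s A₁ B₁ + (1 - t) * Phi p q s A₂ B₂ ≤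
      Phi p q s (t • A₁ + (1 - t) • A₂) (t • B₁ + (1 - t) • B₂) := by
  have hA₀ := posDef_convex_comb hA₁ hA₂ ht₀ ht₁
  have hB₀ := posDef_convex_comb hB₁ hB₂ ht₀ ht₁
  have hA := mpow_concave hq₁.le hq₂ hA₁ hA₂ ht₀ ht₁
  have hB := mpow_concave hp₁.le hp₂ hB₁ hB₂ ht₀ ht₁
  set A₀ := t • A₁ + (1 - t) • A₂
  set B₀ := t • B₁ + (1 - t) • B₂
  let T (A B : Matrix (Fin n) (Fin n) ℂ) := mpow A (q / 2) * mpow B p * mpow A (q / 2)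
  have hT : ∀ {A B : Matrix (Fin n) (Fin n) ℂ}, A.PosDef → B.PosDef → (T A B).PosDef := fun hA hB =>
    posDef_mul_mul (posDef_mpow hA _) (posDef_mpow hB _)
  have sqrt_sq : ∀ {T : Matrix (Fin n) (Fin n) ℂ}, T.PosDef →
      mpow T (1 / 2) * mpow T (1 / 2) = T := fun hT => by
    rw [mpow_half_mul_self hT, mpow_one hT.isHermitian]
  obtain ⟨i₀, k₀⟩ := log_one_add_trace_integral (hT hA₀ hB₀) hs₁ hs₂
  obtain ⟨i₁, k₁⟩ := log_one_add_trace_integral (hT hA₁ hB₁) hs₁ hs₂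
  obtain ⟨i₂, k₂⟩ := log_one_add_trace_integral (hT hA₂ hB₂) hs₁ hs₂
  have hc := integral_log_one_add_mul_rpow_pos (r := 2 * s) (by linarith) (by linarith)
  refine le_of_mul_le_mul_left ?_ hc
  have hle : ∀ u ∈ Ioi (0 : ℝ),
      t * (Real.log ‖(1 + u • mpow (T A₁ B₁) (1 / 2)).det‖ * u ^ (-1 - 2 * s)) +
        (1 - t) * (Real.log ‖(1 + u • mpow (T A₂ B₂) (1 / 2)).det‖ * u ^ (-1 - 2 * s)) ≤
      Real.log ‖(1 + u • mpow (T A₀ B₀) (1 / 2)).det‖ * u ^ (-1 - 2 * s) := by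
    intro u hu
    have h := log_norm_det_one_add_jointly_concave (posDef_mpow hA₀ (q / 2))
      (posDef_mpow hA₁ (q / 2)) (posDef_mpow hA₂ (q / 2)) (posDef_mpow hB₁ p) (posDef_mpow hB₂ p)
      (posDef_mpow (hT hA₀ hB₀) _) (posDef_mpow (hT hA₁ hB₁) _) (posDef_mpow (hT hA₂ hB₂) _)
      (sqrt_sq (hT hA₀ hB₀)) (sqrt_sq (hT hA₁ hB₁)) (sqrt_sq (hT hA₂ hB₂)) ht₀ ht₁ hu
      (by simpa only [mpow_half_mul_self, hA₀, hA₁, hA₂] using hA) hB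
    have h' := mul_le_mul_of_nonneg_right h (Real.rpow_nonneg (le_of_lt hu) (-1 - 2 * s))
    rwa [add_mul, mul_assoc, mul_assoc] at h'
  have hmono := setIntegral_mono_on (Integrable.add (i₁.const_mul t) (i₂.const_mul (1 - t))) i₀
    measurableSet_Ioi hle
  rw [integral_add' (i₁.const_mul t) (i₂.const_mul (1 - t)), integral_const_mul,
    integral_const_mul, k₀, k₁, k₂] at hmono
  change _ * (t * (mpow (T A₁ B₁) s).trace.re + (1 - t) * (mpow (T A₂ B₂) s).trace.re) ≤
    _ * (mpow (T A₀ B₀) s).trace.re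
  linarith

end TraceConcavity

/-- For `0 < p ≤ 1`, `0 < q ≤ 1` and `0 < s < 1/2`, `Φ_{p,q,s}` is jointly concave. -/
theorem phi_jointly_concave_small_s (p q s : ℝ) (hp₁ : 0 < p) (hp₂ : p ≤ 1)
    (hq₁ : 0 < q) (hq₂ : q ≤ 1) (hs₁ : 0 < s) (hs₂ : s < 1 / 2) (n : ℕ) :
    JointlyConcave (Phi (n := n) p q s) := by
  intro A₁ A₂ B₁ B₂ hA₁ hA₂ hB₁ hB₂ t ht₀ ht₁
  exact phi_concave_of_posDef hp₁ hp₂ hq₁ hq₂ hs₁ hs₂ hA₁ hA₂ hB₁ hB₂ ht₀ ht₁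
end

section
/- Let α ∈ (1,2]. Then for every n, the map (ρ,σ) ↦ Tr[(σ^{(1−α)/α} ρ² σ^{(1−α)/α})^{α/2}] is jointly convex on pairs of n×n positive definite complex matrices ρ, σ. -/
open Matrix
open scoped ComplexOrder

/-- Joint convexity of a real-valued function of two positive definite matrices. -/
def JointlyConvex {n : ℕ}
    (f : Matrix (Fin n) (Fin n) ℂ → Matrix (Fin n) (Fin n) ℂ → ℝ) : Prop :=
  ∀ A₁ A₂ B₁ B₂ : Matrix (Fin n) (Fin n) ℂ,
    A₁.PosDef → A₂.PosDef → B₁.PosDef → B₂.PosDef →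
    ∀ t : ℝ, 0 ≤ t → t ≤ 1 →
      f (t • A₁ + (1 - t) • A₂) (t • B₁ + (1 - t) • B₂) ≤
        t * f A₁ B₁ + (1 - t) * f A₂ B₂

open MeasureTheory in
/-- For positive reals, `x ^ (p - 1) * y ^ (-p)` is a mixture of the resolvents
`(x + t * y)⁻¹`. -/
lemma exists_measure_rpow_mul_rpow_eq_integral_resolvent {p : ℝ} (hp : p ∈ Set.Ioo 0 1) :
    ∃ μ : Measure ℝ, ∀ x y : ℝ, 0 < x → 0 < y →
      IntegrableOn (fun t => t ^ (p - 1) * (x + t * y)⁻¹) (Set.Ioi 0) μ ∧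
      x ^ (p - 1) * y ^ (-p) = ∫ t in Set.Ioi 0, t ^ (p - 1) * (x + t * y)⁻¹ ∂μ := by
  obtain ⟨μ, hμ⟩ := Real.exists_measure_rpow_eq_integral_rpowIntegrand₀₁ hp
  refine ⟨μ, fun x y hx hy => ?_⟩
  obtain ⟨hint, heq⟩ := hμ (x / y) (div_pos hx hy).le
  have hfun : Set.EqOn (fun t => x⁻¹ * Real.rpowIntegrand₀₁ p t (x / y))
      (fun t => t ^ (p - 1) * (x + t * y)⁻¹) (Set.Ioi 0) := by
    intro t ht
    have ht' : 0 < t := ht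
    have h : x + t * y ≠ 0 := by positivity
    have h' : t + x / y ≠ 0 := by positivity
    simp only [Real.rpowIntegrand₀₁_eq_pow_div hp ht'.le (div_pos hx hy).le]
    rw [show t + x / y = (x + t * y) / y by field_simp; ring]
    field_simp
  refine ⟨IntegrableOn.congr_fun (hint.const_mul x⁻¹) hfun measurableSet_Ioi, ?_⟩
  rw [← setIntegral_congr_fun measurableSet_Ioi hfun, integral_const_mul, ← heq,
    Real.div_rpow hx.le hy.le, Real.rpow_sub_one hx.ne', Real.rpow_neg hy.le]
  ring

/-- Weighted arithmetic-geometric mean inequality in the form used to linearize `x ^ s`. -/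
lemma rpow_le_mul_rpow_add {x y s : ℝ} (hx : 0 < x) (hy : 0 < y) (hs : 0 < s) (hs' : s ≤ 1) :
    x ^ s ≤ s * (x * y ^ (1 - 1 / s)) + (1 - s) * y := by
  have h := Real.geom_mean_le_arith_mean2_weighted hs.le (sub_nonneg.2 hs')
    (mul_pos hx (Real.rpow_pos_of_pos hy (1 - 1 / s))).le hy.le (by ring)
  rwa [Real.mul_rpow hx.le (Real.rpow_pos_of_pos hy _).le, ← Real.rpow_mul hy.le, mul_assoc,
    ← Real.rpow_add hy, show (1 - 1 / s) * s + (1 - s) = 0 by field_simp; ring, Real.rpow_zero,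
    mul_one] at h

namespace Matrix

section SpectralForm

variable {m : Type*} [Fintype m] [DecidableEq m]

lemma re_trace_conj_diagonal_mul (U V K : Matrix m m ℂ) (d e : m → ℝ) :
    (trace (U * diagonal (fun i => (d i : ℂ)) * Uᴴ * K *
      (V * diagonal (fun i => (e i : ℂ)) * Vᴴ) * Kᴴ)).re =
      ∑ i, ∑ j, d i * e j * Complex.normSq ((Uᴴ * K * V) i j) := by
  have h : trace (U * diagonal (fun i => (d i : ℂ)) * Uᴴ * K *
      (V * diagonal (fun i => (e i : ℂ)) * Vᴴ) * Kᴴ) =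
      trace (diagonal (fun i => (d i : ℂ)) * (Uᴴ * K * V) *
        diagonal (fun i => (e i : ℂ)) * (Uᴴ * K * V)ᴴ) := by
    simp only [conjTranspose_mul, conjTranspose_conjTranspose, mul_assoc]
    rw [trace_mul_comm U]
    simp only [mul_assoc]
  rw [h, trace, Complex.re_sum]
  refine Finset.sum_congr rfl fun i _ => ?_
  rw [diag_apply, mul_apply, Complex.re_sum]
  refine Finset.sum_congr rfl fun j _ => ?_
  rw [mul_diagonal, diagonal_mul, conjTranspose_apply, Complex.star_def,
    show (d i : ℂ) * (Uᴴ * K * V) i j * (e j : ℂ) * (starRingEnd ℂ) ((Uᴴ * K * V) i j) =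
      ((d i * e j : ℝ) : ℂ) * ((Uᴴ * K * V) i j * (starRingEnd ℂ) ((Uᴴ * K * V) i j)) by
      push_cast; ring, Complex.mul_conj, ← Complex.ofReal_mul, Complex.ofReal_re]

/-- The quadratic form `K ↦ ⟨K, g(L_σ, R_ζ) K⟩`, where `L_σ` and `R_ζ` are the commuting operators
of left multiplication by `σ` and right multiplication by `ζ`. -/
noncomputable def spectralForm (g : ℝ → ℝ → ℝ) {σ ζ : Matrix m m ℂ} (hσ : σ.IsHermitian)
    (hζ : ζ.IsHermitian) (K : Matrix m m ℂ) : ℝ :=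
  ∑ i, ∑ j, g (hσ.eigenvalues i) (hζ.eigenvalues j) *
    Complex.normSq (((hσ.eigenvectorUnitary : Matrix m m ℂ)ᴴ * K * hζ.eigenvectorUnitary) i j)

lemma IsHermitian.eq_conj_diagonal {A : Matrix m m ℂ} (hA : A.IsHermitian) :
    A = (hA.eigenvectorUnitary : Matrix m m ℂ) *
      diagonal (fun i => (hA.eigenvalues i : ℂ)) * (hA.eigenvectorUnitary : Matrix m m ℂ)ᴴ := by
  conv_lhs => rw [hA.spectral_theorem]
  rfl

lemma IsHermitian.conjTranspose_eigenvectorUnitary_mul {A : Matrix m m ℂ} (hA : A.IsHermitian) :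
    (hA.eigenvectorUnitary : Matrix m m ℂ)ᴴ * hA.eigenvectorUnitary = 1 :=
  Unitary.coe_star_mul_self hA.eigenvectorUnitary

lemma IsHermitian.eigenvectorUnitary_mul_conjTranspose {A : Matrix m m ℂ} (hA : A.IsHermitian) :
    (hA.eigenvectorUnitary : Matrix m m ℂ) * (hA.eigenvectorUnitary : Matrix m m ℂ)ᴴ = 1 :=
  Unitary.coe_mul_star_self hA.eigenvectorUnitary

lemma spectralForm_left {σ ζ : Matrix m m ℂ} (hσ : σ.IsHermitian) (hζ : ζ.IsHermitian)
    (K : Matrix m m ℂ) :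
    spectralForm (fun x _ => x) hσ hζ K = (trace (σ * K * Kᴴ)).re := by
  have h := re_trace_conj_diagonal_mul (hσ.eigenvectorUnitary : Matrix m m ℂ)
    hζ.eigenvectorUnitary K hσ.eigenvalues 1
  simp only [← hσ.eq_conj_diagonal, Pi.one_apply, Complex.ofReal_one, diagonal_one, mul_one,
    hζ.eigenvectorUnitary_mul_conjTranspose] at h
  exact h.symm

lemma spectralForm_right {σ ζ : Matrix m m ℂ} (hσ : σ.IsHermitian) (hζ : ζ.IsHermitian)
    (K : Matrix m m ℂ) :
    spectralForm (fun _ y => y) hσ hζ K = (trace (K * ζ * Kᴴ)).re := by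
  have h := re_trace_conj_diagonal_mul (hσ.eigenvectorUnitary : Matrix m m ℂ)
    hζ.eigenvectorUnitary K 1 hζ.eigenvalues
  simp only [← hζ.eq_conj_diagonal, Pi.one_apply, Complex.ofReal_one, diagonal_one, mul_one,
    one_mul, hσ.eigenvectorUnitary_mul_conjTranspose] at h
  exact h.symm

/-- The function whose maximum over `Y` is `⟨K, (L_σ + t R_ζ)⁻¹ K⟩`. -/
noncomputable def resolventLagrangian (t : ℝ) (σ ζ K Y : Matrix m m ℂ) : ℝ :=
  2 * (trace (K * Yᴴ)).re - (trace (σ * Y * Yᴴ)).re - t * (trace (Y * ζ * Yᴴ)).re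

lemma resolventLagrangian_combo (t s : ℝ) (σ₁ σ₂ ζ₁ ζ₂ K₁ K₂ Y : Matrix m m ℂ) :
    resolventLagrangian t (s • σ₁ + (1 - s) • σ₂) (s • ζ₁ + (1 - s) • ζ₂)
      (s • K₁ + (1 - s) • K₂) Y =
      s * resolventLagrangian t σ₁ ζ₁ K₁ Y + (1 - s) * resolventLagrangian t σ₂ ζ₂ K₂ Y := by
  simp only [resolventLagrangian, add_mul, mul_add, smul_mul_assoc, mul_smul_comm, trace_add,
    trace_smul, Complex.add_re, Complex.smul_re, smul_eq_mul]
  ring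

lemma resolventLagrangian_eq_sum (t : ℝ) {σ ζ : Matrix m m ℂ} (hσ : σ.IsHermitian)
    (hζ : ζ.IsHermitian) (K Y : Matrix m m ℂ) :
    resolventLagrangian t σ ζ K Y = ∑ i, ∑ j,
      (2 * ((((hσ.eigenvectorUnitary : Matrix m m ℂ)ᴴ * K * hζ.eigenvectorUnitary) i j) *
        star (((hσ.eigenvectorUnitary : Matrix m m ℂ)ᴴ * Y * hζ.eigenvectorUnitary) i j)).re -
      (hσ.eigenvalues i + t * hζ.eigenvalues j) * Complex.normSq
        (((hσ.eigenvectorUnitary : Matrix m m ℂ)ᴴ * Y * hζ.eigenvectorUnitary) i j)) := by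
  have h : trace (K * Yᴴ) = trace
      (((hσ.eigenvectorUnitary : Matrix m m ℂ)ᴴ * K * (hζ.eigenvectorUnitary : Matrix m m ℂ)) *
      ((hσ.eigenvectorUnitary : Matrix m m ℂ)ᴴ * Y * (hζ.eigenvectorUnitary : Matrix m m ℂ))ᴴ) := by
    simp only [conjTranspose_mul, conjTranspose_conjTranspose, mul_assoc]
    rw [trace_mul_comm (hσ.eigenvectorUnitary : Matrix m m ℂ)ᴴ]
    simp only [mul_assoc, hσ.eigenvectorUnitary_mul_conjTranspose, mul_one]
    rw [← mul_assoc (hζ.eigenvectorUnitary : Matrix m m ℂ),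
      hζ.eigenvectorUnitary_mul_conjTranspose, one_mul]
  have h' (M N : Matrix m m ℂ) : (trace (M * Nᴴ)).re = ∑ i, ∑ j, (M i j * star (N i j)).re := by
    simp only [trace, diag_apply, mul_apply, Complex.re_sum, conjTranspose_apply]
  rw [resolventLagrangian, ← spectralForm_left hσ hζ, ← spectralForm_right hσ hζ, h, h']
  simp only [spectralForm, Finset.mul_sum, ← Finset.sum_sub_distrib]
  refine Finset.sum_congr rfl fun i _ => Finset.sum_congr rfl fun j _ => ?_
  ring

lemma resolventLagrangian_le {t : ℝ} (ht : 0 ≤ t) {σ ζ : Matrix m m ℂ} (hσ : σ.PosDef)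
    (hζ : ζ.PosDef) (K Y : Matrix m m ℂ) :
    resolventLagrangian t σ ζ K Y ≤ spectralForm (fun x y => (x + t * y)⁻¹) hσ.1 hζ.1 K := by
  rw [resolventLagrangian_eq_sum t hσ.1 hζ.1, spectralForm]
  refine Finset.sum_le_sum fun i _ => Finset.sum_le_sum fun j _ => ?_
  have hc : 0 < hσ.1.eigenvalues i + t * hζ.1.eigenvalues j :=
    add_pos_of_pos_of_nonneg (hσ.eigenvalues_pos i) (mul_nonneg ht (hζ.eigenvalues_pos j).le)
  generalize hσ.1.eigenvalues i + t * hζ.1.eigenvalues j = c at *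
  generalize ((hσ.1.eigenvectorUnitary : Matrix m m ℂ)ᴴ * K * hζ.1.eigenvectorUnitary) i j = a
  generalize ((hσ.1.eigenvectorUnitary : Matrix m m ℂ)ᴴ * Y * hζ.1.eigenvectorUnitary) i j = b
  have h : c⁻¹ * Complex.normSq a - (2 * (a * star b).re - c * Complex.normSq b) =
      c⁻¹ * ((a.re - c * b.re) ^ 2 + (a.im - c * b.im) ^ 2) := by
    simp only [Complex.normSq_apply, Complex.mul_re, Complex.star_def, Complex.conj_re,
      Complex.conj_im]
    field_simp
    ring
  have : 0 ≤ c⁻¹ * ((a.re - c * b.re) ^ 2 + (a.im - c * b.im) ^ 2) := by positivity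
  linarith

lemma exists_resolventLagrangian_eq {t : ℝ} (ht : 0 ≤ t) {σ ζ : Matrix m m ℂ} (hσ : σ.PosDef)
    (hζ : ζ.PosDef) (K : Matrix m m ℂ) :
    ∃ Y, resolventLagrangian t σ ζ K Y =
      spectralForm (fun x y => (x + t * y)⁻¹) hσ.1 hζ.1 K := by
  set U := (hσ.1.eigenvectorUnitary : Matrix m m ℂ) with hU
  set V := (hζ.1.eigenvectorUnitary : Matrix m m ℂ) with hV
  let N : Matrix m m ℂ := of fun i j =>
    (((hσ.1.eigenvalues i + t * hζ.1.eigenvalues j)⁻¹ : ℝ) : ℂ) * (Uᴴ * K * V) i j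
  refine ⟨U * N * Vᴴ, ?_⟩
  have hN : Uᴴ * (U * N * Vᴴ) * V = N := by
    rw [mul_assoc, mul_assoc (U * N), hV, hζ.1.conjTranspose_eigenvectorUnitary_mul, mul_one,
      ← mul_assoc, hU, hσ.1.conjTranspose_eigenvectorUnitary_mul, one_mul]
  rw [resolventLagrangian_eq_sum t hσ.1 hζ.1, spectralForm]
  simp only [← hU, ← hV, hN]
  refine Finset.sum_congr rfl fun i _ => Finset.sum_congr rfl fun j _ => ?_
  have hc : 0 < hσ.1.eigenvalues i + t * hζ.1.eigenvalues j :=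
    add_pos_of_pos_of_nonneg (hσ.eigenvalues_pos i) (mul_nonneg ht (hζ.eigenvalues_pos j).le)
  simp only [N, of_apply]
  generalize hσ.1.eigenvalues i + t * hζ.1.eigenvalues j = c at *
  generalize (Uᴴ * K * V) i j = a
  simp only [Complex.normSq_apply, Complex.mul_re, Complex.mul_im, Complex.star_def,
    Complex.conj_re, Complex.conj_im, Complex.ofReal_re, Complex.ofReal_im]
  field_simp
  ring

/-- `g` induces a jointly convex function `(σ, ζ, K) ↦ ⟨K, g(L_σ, R_ζ) K⟩`. -/
def SpectralFormConvex (m : Type*) [Fintype m] [DecidableEq m] (g : ℝ → ℝ → ℝ) : Prop :=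
  ∀ ⦃σ₁ σ₂ ζ₁ ζ₂ : Matrix m m ℂ⦄ (hσ₁ : σ₁.PosDef) (hσ₂ : σ₂.PosDef) (hζ₁ : ζ₁.PosDef)
    (hζ₂ : ζ₂.PosDef) (K₁ K₂ : Matrix m m ℂ) ⦃s : ℝ⦄, 0 ≤ s → s ≤ 1 →
    ∀ (hσ : (s • σ₁ + (1 - s) • σ₂).PosDef) (hζ : (s • ζ₁ + (1 - s) • ζ₂).PosDef),
    spectralForm g hσ.1 hζ.1 (s • K₁ + (1 - s) • K₂) ≤
      s * spectralForm g hσ₁.1 hζ₁.1 K₁ + (1 - s) * spectralForm g hσ₂.1 hζ₂.1 K₂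

lemma spectralFormConvex_resolvent {t : ℝ} (ht : 0 ≤ t) :
    SpectralFormConvex m (fun x y => (x + t * y)⁻¹) := by
  intro σ₁ σ₂ ζ₁ ζ₂ hσ₁ hσ₂ hζ₁ hζ₂ K₁ K₂ s hs hs' hσ hζ
  obtain ⟨Y, hY⟩ := exists_resolventLagrangian_eq ht hσ hζ (s • K₁ + (1 - s) • K₂)
  rw [← hY, resolventLagrangian_combo]
  exact add_le_add
    (mul_le_mul_of_nonneg_left (resolventLagrangian_le ht hσ₁ hζ₁ K₁ Y) hs)
    (mul_le_mul_of_nonneg_left (resolventLagrangian_le ht hσ₂ hζ₂ K₂ Y) (sub_nonneg.2 hs'))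

open MeasureTheory in
/-- **Lieb's joint convexity theorem** for `(σ, ζ, K) ↦ Tr (σ ^ (p - 1) * K * ζ ^ (-p) * Kᴴ)`. -/
lemma spectralFormConvex_rpow {p : ℝ} (hp : 0 ≤ p) (hp' : p < 1) :
    SpectralFormConvex m (fun x y => x ^ (p - 1) * y ^ (-p)) := by
  rcases hp.eq_or_lt with rfl | hp
  · simpa [Real.rpow_neg_one] using spectralFormConvex_resolvent (m := m) le_rfl
  obtain ⟨μ, hμ⟩ := exists_measure_rpow_mul_rpow_eq_integral_resolvent ⟨hp, hp'⟩
  have key : ∀ ⦃σ ζ : Matrix m m ℂ⦄ (hσ : σ.PosDef) (hζ : ζ.PosDef) (K : Matrix m m ℂ),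
      IntegrableOn (fun t => t ^ (p - 1) *
        spectralForm (fun x y => (x + t * y)⁻¹) hσ.1 hζ.1 K) (Set.Ioi 0) μ ∧
      spectralForm (fun x y => x ^ (p - 1) * y ^ (-p)) hσ.1 hζ.1 K =
        ∫ t in Set.Ioi 0, t ^ (p - 1) *
          spectralForm (fun x y => (x + t * y)⁻¹) hσ.1 hζ.1 K ∂μ := by
    intro σ ζ hσ hζ K
    have hint := fun i j => hμ _ _ (hσ.eigenvalues_pos i) (hζ.eigenvalues_pos j)
    simp only [spectralForm, Finset.mul_sum, ← mul_assoc]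
    refine ⟨integrable_finsetSum _ fun i _ => integrable_finsetSum _ fun j _ =>
      (hint i j).1.mul_const _, ?_⟩
    rw [integral_finsetSum _ fun i _ => integrable_finsetSum _ fun j _ =>
      (hint i j).1.mul_const _]
    refine Finset.sum_congr rfl fun i _ => ?_
    rw [integral_finsetSum _ fun j _ => (hint i j).1.mul_const _]
    refine Finset.sum_congr rfl fun j _ => ?_
    rw [integral_mul_const, ← (hint i j).2]
  intro σ₁ σ₂ ζ₁ ζ₂ hσ₁ hσ₂ hζ₁ hζ₂ K₁ K₂ s hs hs' hσ hζ
  rw [(key hσ hζ _).2, (key hσ₁ hζ₁ _).2, (key hσ₂ hζ₂ _).2, ← integral_const_mul,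
    ← integral_const_mul, ← integral_add ((key hσ₁ hζ₁ _).1.const_mul _)
      ((key hσ₂ hζ₂ _).1.const_mul _)]
  refine setIntegral_mono_on (key hσ hζ _).1 (((key hσ₁ hζ₁ _).1.const_mul _).add
      ((key hσ₂ hζ₂ _).1.const_mul _)) measurableSet_Ioi fun t ht => ?_
  have h := mul_le_mul_of_nonneg_left (spectralFormConvex_resolvent (le_of_lt ht) hσ₁ hσ₂ hζ₁ hζ₂
    K₁ K₂ hs hs' hσ hζ) (Real.rpow_nonneg (le_of_lt ht) (p - 1))
  linarith

end SpectralForm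

section RealPower

variable {n : ℕ} {A σ ζ : Matrix (Fin n) (Fin n) ℂ}

lemma IsHermitian.mpow_eq (hA : A.IsHermitian) (r : ℝ) :
    mpow A r = (hA.eigenvectorUnitary : Matrix (Fin n) (Fin n) ℂ) *
      diagonal (fun i => ((hA.eigenvalues i ^ r : ℝ) : ℂ)) *
      (hA.eigenvectorUnitary : Matrix (Fin n) (Fin n) ℂ)ᴴ := by
  rw [mpow, dif_pos hA]
  rfl

lemma IsHermitian.mpow_zero (hA : A.IsHermitian) : mpow A 0 = 1 := by
  simp [hA.mpow_eq, hA.eigenvectorUnitary_mul_conjTranspose]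

lemma IsHermitian.mpow_one (hA : A.IsHermitian) : mpow A 1 = A := by
  simp only [hA.mpow_eq, Real.rpow_one, ← hA.eq_conj_diagonal]

lemma IsHermitian.isHermitian_mpow (hA : A.IsHermitian) (r : ℝ) : (mpow A r).IsHermitian := by
  rw [hA.mpow_eq]
  refine isHermitian_mul_mul_conjTranspose _ ?_
  exact isHermitian_diagonal_of_self_adjoint _ (by ext i; simp)

lemma PosDef.posDef_mpow (hA : A.PosDef) (r : ℝ) : (mpow A r).PosDef := by
  rw [hA.1.mpow_eq]
  have hd : (diagonal (fun i => ((hA.1.eigenvalues i ^ r : ℝ) : ℂ))).PosDef :=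
    PosDef.diagonal fun i => by exact_mod_cast Real.rpow_pos_of_pos (hA.eigenvalues_pos i) r
  refine hd.mul_mul_conjTranspose_same ?_
  exact vecMul_injective_of_isUnit (IsUnit.of_mul_eq_one _
    hA.1.eigenvectorUnitary_mul_conjTranspose)

lemma PosDef.mpow_mul_mpow (hA : A.PosDef) (r s : ℝ) : mpow A r * mpow A s = mpow A (r + s) := by
  simp only [hA.1.mpow_eq, mul_assoc]
  rw [← mul_assoc (hA.1.eigenvectorUnitary : Matrix (Fin n) (Fin n) ℂ)ᴴ,
    hA.1.conjTranspose_eigenvectorUnitary_mul, one_mul, ← mul_assoc (diagonal _),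
    diagonal_mul_diagonal]
  simp only [← Complex.ofReal_mul, ← Real.rpow_add (hA.eigenvalues_pos _)]

/-- Real powers may be computed from any unitary diagonalization. -/
lemma IsHermitian.mpow_eq_of_eq_conj_diagonal (hA : A.IsHermitian)
    {W : Matrix (Fin n) (Fin n) ℂ} {d : Fin n → ℝ} (hW : Wᴴ * W = 1)
    (h : A = W * diagonal (fun i => (d i : ℂ)) * Wᴴ) (r : ℝ) :
    mpow A r = W * diagonal (fun i => ((d i ^ r : ℝ) : ℂ)) * Wᴴ := by
  have hW' : W * Wᴴ = 1 := mul_eq_one_comm.1 hW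
  set V := (hA.eigenvectorUnitary : Matrix (Fin n) (Fin n) ℂ) with hV
  have hVV : Vᴴ * V = 1 := hA.conjTranspose_eigenvectorUnitary_mul
  have hVV' : V * Vᴴ = 1 := hA.eigenvectorUnitary_mul_conjTranspose
  have h₁ : diagonal (fun i => (hA.eigenvalues i : ℂ)) * (Vᴴ * W) =
      (Vᴴ * W) * diagonal (fun i => (d i : ℂ)) := by
    have h₂ := hA.eq_conj_diagonal.symm.trans h
    rw [← hV] at h₂
    calc _ = Vᴴ * (V * diagonal (fun i => (hA.eigenvalues i : ℂ)) * Vᴴ) * W := by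
          simp only [← mul_assoc, hVV, one_mul]
      _ = _ := by rw [h₂]; simp only [mul_assoc, hW, mul_one]
  have h₃ : diagonal (fun i => ((hA.eigenvalues i ^ r : ℝ) : ℂ)) * (Vᴴ * W) =
      (Vᴴ * W) * diagonal (fun i => ((d i ^ r : ℝ) : ℂ)) := by
    ext i j
    have hij := congrFun₂ h₁ i j
    rw [diagonal_mul, mul_diagonal] at hij ⊢
    by_cases h0 : (Vᴴ * W) i j = 0
    · simp [h0]
    · rw [mul_comm] at hij
      have := Complex.ofReal_injective (mul_left_cancel₀ h0 hij)
      rw [this, mul_comm]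
  rw [hA.mpow_eq, ← hV]
  calc _ = V * (diagonal (fun i => ((hA.eigenvalues i ^ r : ℝ) : ℂ)) * (Vᴴ * W)) * Wᴴ := by
        simp only [mul_assoc, hW', mul_one]
    _ = _ := by rw [h₃]; simp only [← mul_assoc, hVV', one_mul]

lemma PosDef.mpow_mpow (hA : A.PosDef) (r s : ℝ) : mpow (mpow A r) s = mpow A (r * s) := by
  rw [(hA.1.isHermitian_mpow r).mpow_eq_of_eq_conj_diagonal
    hA.1.conjTranspose_eigenvectorUnitary_mul (hA.1.mpow_eq r), hA.1.mpow_eq]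
  simp only [← Real.rpow_mul (hA.eigenvalues_pos _).le]

lemma re_trace_mpow_mul_mpow (hσ : σ.IsHermitian) (hζ : ζ.IsHermitian)
    (K : Matrix (Fin n) (Fin n) ℂ) (r q : ℝ) :
    (trace (mpow σ r * K * mpow ζ q * Kᴴ)).re =
      spectralForm (fun x y => x ^ r * y ^ q) hσ hζ K := by
  rw [hσ.mpow_eq, hζ.mpow_eq, re_trace_conj_diagonal_mul, spectralForm]

lemma trace_mpow (hA : A.IsHermitian) (r : ℝ) :
    trace (mpow A r) = ∑ i, ((hA.eigenvalues i ^ r : ℝ) : ℂ) := by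
  rw [hA.mpow_eq, trace_mul_comm, ← mul_assoc, hA.conjTranspose_eigenvectorUnitary_mul, one_mul,
    trace_diagonal]

lemma trace_mpow_mul_comm {X Y : Matrix (Fin n) (Fin n) ℂ} (hXY : (X * Y).IsHermitian)
    (hYX : (Y * X).IsHermitian) (r : ℝ) :
    trace (mpow (X * Y) r) = trace (mpow (Y * X) r) := by
  rw [trace_mpow hXY, trace_mpow hYX,
    (hXY.eigenvalues_eq_eigenvalues_iff hYX).2 (charpoly_mul_comm X Y)]

/-- Variational bound for the trace of a power with exponent in `(0, 1]`. -/
lemma re_trace_mpow_le (hA : A.PosDef) (hζ : ζ.PosDef) {s : ℝ} (hs : 0 < s) (hs' : s ≤ 1) :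
    (trace (mpow A s)).re ≤
      s * (trace (A * mpow ζ (1 - 1 / s))).re + (1 - s) * (trace ζ).re := by
  have h₁ := re_trace_mpow_mul_mpow hA.1 hζ.1 1 s 0
  have h₂ := re_trace_mpow_mul_mpow hA.1 hζ.1 1 1 (1 - 1 / s)
  have h₃ := re_trace_mpow_mul_mpow hA.1 hζ.1 1 0 1
  simp only [hA.1.mpow_zero, hA.1.mpow_one, hζ.1.mpow_zero, hζ.1.mpow_one, conjTranspose_one,
    mul_one, one_mul] at h₁ h₂ h₃
  rw [h₁, h₂, h₃]
  simp only [spectralForm, Finset.mul_sum, ← Finset.sum_add_distrib]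
  refine Finset.sum_le_sum fun i _ => Finset.sum_le_sum fun j _ => ?_
  have := mul_le_mul_of_nonneg_right (rpow_le_mul_rpow_add (hA.eigenvalues_pos i)
    (hζ.eigenvalues_pos j) hs hs') (Complex.normSq_nonneg
      (((hA.1.eigenvectorUnitary : Matrix (Fin n) (Fin n) ℂ)ᴴ *
        (hζ.1.eigenvectorUnitary : Matrix (Fin n) (Fin n) ℂ)) i j))
  simp only [Real.rpow_zero, Real.rpow_one, mul_one, one_mul] at this ⊢
  linarith

lemma re_trace_mpow_eq (hA : A.PosDef) {s : ℝ} (hs : 0 < s) :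
    (trace (mpow A s)).re =
      s * (trace (A * mpow (mpow A s) (1 - 1 / s))).re + (1 - s) * (trace (mpow A s)).re := by
  have h : A * mpow (mpow A s) (1 - 1 / s) = mpow A s := by
    rw [hA.mpow_mpow]
    nth_rw 1 [← hA.1.mpow_one]
    rw [hA.mpow_mul_mpow, show 1 + s * (1 - 1 / s) = s by field_simp; ring]
  rw [h]
  ring

lemma PosDef.smul_add_smul {m : Type*} {X Y : Matrix m m ℂ} (hX : X.PosDef) (hY : Y.PosDef)
    {t : ℝ} (ht : 0 ≤ t) (ht' : t ≤ 1) : (t • X + (1 - t) • Y).PosDef := by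
  rcases ht.eq_or_lt with rfl | ht
  · simpa using hY
  · exact (hX.smul ht).add_posSemidef (hY.posSemidef.smul (sub_nonneg.2 ht'))

end RealPower

end Matrix

/-- For `α ∈ (1,2]`, the map
`(ρ,σ) ↦ Tr[(σ^{(1−α)/α} ρ² σ^{(1−α)/α})^{α/2}]` is jointly convex. -/
theorem renyi_trace_jointly_convex (α : ℝ) (hα₁ : 1 < α) (hα₂ : α ≤ 2) (n : ℕ) :
    JointlyConvex (fun ρ σ : Matrix (Fin n) (Fin n) ℂ =>
      (Matrix.trace
        (mpow (mpow σ ((1 - α) / α) * (ρ * ρ) * mpow σ ((1 - α) / α)) (α / 2))).re) := by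
  have hα : 0 < α := by linarith
  have hs : 0 < α / 2 := by positivity
  have hs' : α / 2 ≤ 1 := by linarith
  set p : ℝ := 1 / (α / 2) - 1 with hp_def
  have hp : 0 ≤ p := by
    rw [hp_def, sub_nonneg, le_div_iff₀ hs]
    linarith
  have hp' : p < 1 := by
    rw [hp_def, sub_lt_iff_lt_add, div_lt_iff₀ hs]
    linarith
  have hexp : (1 - α) / α + (1 - α) / α = p - 1 := by
    rw [hp_def]
    field_simp
    ring
  have hneg : 1 - 1 / (α / 2) = -p := by rw [hp_def]; ring
  have hpos : ∀ {ρ σ : Matrix (Fin n) (Fin n) ℂ}, ρ.PosDef → σ.PosDef →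
      (ρ * mpow σ (p - 1) * ρ).PosDef := fun {ρ σ} hρ hσ => by
    have h := (hσ.posDef_mpow (p - 1)).mul_mul_conjTranspose_same (B := ρ)
      (vecMul_injective_of_isUnit hρ.isUnit)
    rwa [hρ.1.eq] at h
  have hswap : ∀ {ρ σ : Matrix (Fin n) (Fin n) ℂ}, ρ.PosDef → σ.PosDef →
      trace (mpow (mpow σ ((1 - α) / α) * (ρ * ρ) * mpow σ ((1 - α) / α)) (α / 2)) =
        trace (mpow (ρ * mpow σ (p - 1) * ρ) (α / 2)) := fun {ρ σ} hρ hσ => by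
    have h₁ : mpow σ ((1 - α) / α) * (ρ * ρ) * mpow σ ((1 - α) / α) =
        (mpow σ ((1 - α) / α) * ρ) * (ρ * mpow σ ((1 - α) / α)) := by simp only [mul_assoc]
    have h₂ : ρ * mpow σ (p - 1) * ρ =
        (ρ * mpow σ ((1 - α) / α)) * (mpow σ ((1 - α) / α) * ρ) := by
      rw [← hexp, ← hσ.mpow_mul_mpow]
      simp only [mul_assoc]
    rw [h₁, h₂]
    refine trace_mpow_mul_comm ?_ (h₂ ▸ (hpos hρ hσ).1) _
    simp [IsHermitian, conjTranspose_mul, hρ.1.eq, (hσ.1.isHermitian_mpow _).eq]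
  have hform : ∀ {ρ σ ζ : Matrix (Fin n) (Fin n) ℂ} (_ : ρ.PosDef) (hσ : σ.PosDef)
      (hζ : ζ.PosDef), (trace (ρ * mpow σ (p - 1) * ρ * mpow ζ (1 - 1 / (α / 2)))).re =
        spectralForm (fun x y => x ^ (p - 1) * y ^ (-p)) hσ.1 hζ.1 ρ :=
      fun {ρ σ ζ} hρ hσ hζ => by
    rw [← re_trace_mpow_mul_mpow, hρ.1.eq, hneg, mul_assoc, mul_assoc, trace_mul_comm]
    simp only [mul_assoc]
  intro ρ₁ ρ₂ σ₁ σ₂ hρ₁ hρ₂ hσ₁ hσ₂ t ht ht'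
  have hρ := hρ₁.smul_add_smul hρ₂ ht ht'
  have hσ := hσ₁.smul_add_smul hσ₂ ht ht'
  have hζ₁ := (hpos hρ₁ hσ₁).posDef_mpow (α / 2)
  have hζ₂ := (hpos hρ₂ hσ₂).posDef_mpow (α / 2)
  have hζ := hζ₁.smul_add_smul hζ₂ ht ht'
  have hle := re_trace_mpow_le (hpos hρ hσ) hζ hs hs'
  have h₁ := re_trace_mpow_eq (hpos hρ₁ hσ₁) hs
  have h₂ := re_trace_mpow_eq (hpos hρ₂ hσ₂) hs
  have hconv := mul_le_mul_of_nonneg_left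
    (spectralFormConvex_rpow hp hp' hσ₁ hσ₂ hζ₁ hζ₂ ρ₁ ρ₂ ht ht' hσ hζ) hs.le
  rw [hform hρ hσ hζ] at hle
  rw [hform hρ₁ hσ₁ hζ₁] at h₁
  rw [hform hρ₂ hσ₂ hζ₂] at h₂
  simp only [trace_add, trace_smul, Complex.add_re, Complex.smul_re, smul_eq_mul] at hle
  simp only [hswap hρ hσ, hswap hρ₁ hσ₁, hswap hρ₂ hσ₂]
  linear_combination hle + hconv - t * h₁ - (1 - t) * h₂
end

section
/- For real numbers p, q, the function f(a,b) = a^q b^p is jointly convex on (0,∞) × (0,∞) if and only if one of the following holds: (i) p ≥ 1, q ≤ 0, and p + q ≥ 1; (ii) q ≥ 1, p ≤ 0, and p + q ≥ 1; (iii) p ≤ 0 and q ≤ 0. -/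
open Filter Topology in
/-- Some `R > 1` makes two given negative powers of `R` simultaneously small. -/
theorem exists_rpow_neg_add_rpow_neg_lt {u v δ : ℝ} (hu : 0 < u) (hv : 0 < v) (hδ : 0 < δ) :
    ∃ R : ℝ, 1 < R ∧ R ^ (-u) + R ^ (-v) < δ := by
  have h : Tendsto (fun R : ℝ => R ^ (-u) + R ^ (-v)) atTop (𝓝 (0 + 0)) :=
    (tendsto_rpow_neg_atTop hu).add (tendsto_rpow_neg_atTop hv)
  rw [add_zero] at h
  exact ((eventually_gt_atTop 1).and (h.eventually_lt_const hδ)).exists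

/-- A function `(a, b) ↦ a ^ q * b ^ p` lying above its tangent plane at `(1, 1)` satisfies
Jensen's inequality for two points. -/
theorem rpow_mul_rpow_jensen_of_tangent {p q : ℝ}
    (h : ∀ x y : ℝ, 0 < x → 0 < y → q * x + p * y + (1 - p - q) ≤ x ^ q * y ^ p)
    {a₁ a₂ b₁ b₂ : ℝ} (ha₁ : 0 < a₁) (ha₂ : 0 < a₂) (hb₁ : 0 < b₁) (hb₂ : 0 < b₂)
    {t : ℝ} (ht₀ : 0 ≤ t) (ht₁ : t ≤ 1) :
    (t * a₁ + (1 - t) * a₂) ^ q * (t * b₁ + (1 - t) * b₂) ^ p ≤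
      t * (a₁ ^ q * b₁ ^ p) + (1 - t) * (a₂ ^ q * b₂ ^ p) := by
  have pos : ∀ {x y : ℝ}, 0 < x → 0 < y → 0 < t * x + (1 - t) * y := by
    intro x y hx hy
    rcases ht₀.eq_or_lt with rfl | ht
    · simpa using hy
    · have := mul_nonneg (sub_nonneg.2 ht₁) hy.le
      positivity
  have hA := pos ha₁ ha₂
  have hB := pos hb₁ hb₂
  set A := t * a₁ + (1 - t) * a₂ with hAdef
  set B := t * b₁ + (1 - t) * b₂ with hBdef
  have key : ∀ a b : ℝ, 0 < a → 0 < b →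
      A ^ q * B ^ p * (q * (a / A) + p * (b / B) + (1 - p - q)) ≤ a ^ q * b ^ p := by
    intro a b ha hb
    have h' := h (a / A) (b / B) (by positivity) (by positivity)
    rw [Real.div_rpow ha.le hA.le, Real.div_rpow hb.le hB.le] at h'
    calc _ ≤ A ^ q * B ^ p * (a ^ q / A ^ q * (b ^ p / B ^ p)) := by gcongr
      _ = a ^ q * b ^ p := by
        have := (Real.rpow_pos_of_pos hA q).ne'
        have := (Real.rpow_pos_of_pos hB p).ne'
        field_simp
  have h₁ := mul_le_mul_of_nonneg_left (key a₁ b₁ ha₁ hb₁) ht₀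
  have h₂ := mul_le_mul_of_nonneg_left (key a₂ b₂ ha₂ hb₂) (sub_nonneg.2 ht₁)
  have hAA : t * (a₁ / A) + (1 - t) * (a₂ / A) = 1 := by
    rw [← mul_div_assoc, ← mul_div_assoc, ← add_div, ← hAdef, div_self hA.ne']
  have hBB : t * (b₁ / B) + (1 - t) * (b₂ / B) = 1 := by
    rw [← mul_div_assoc, ← mul_div_assoc, ← add_div, ← hBdef, div_self hB.ne']
  refine le_trans (le_of_eq ?_) (add_le_add h₁ h₂)
  linear_combination (-(A ^ q * B ^ p)) * (q * hAA + p * hBB)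

theorem rpow_mul_rpow_tangent_of_one_le {p q : ℝ} (hp : 1 ≤ p) (hq : q ≤ 0) (hpq : 1 ≤ p + q)
    {x y : ℝ} (hx : 0 < x) (hy : 0 < y) :
    q * x + p * y + (1 - p - q) ≤ x ^ q * y ^ p := by
  have hp₀ : 0 < p := by linarith
  have h := Real.geom_mean_le_arith_mean3_weighted (w₁ := 1 / p) (w₂ := -q / p)
    (w₃ := (p + q - 1) / p) (p₁ := x ^ q * y ^ p) (p₂ := x) (p₃ := 1) (by positivity)
    (div_nonneg (by linarith) hp₀.le) (div_nonneg (by linarith) hp₀.le) (by positivity) hx.le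
    zero_le_one (by field_simp; ring)
  have e : (x ^ q * y ^ p) ^ (1 / p) * x ^ (-q / p) * 1 ^ ((p + q - 1) / p) = y := by
    rw [Real.mul_rpow (by positivity) (by positivity), ← Real.rpow_mul hx.le,
      ← Real.rpow_mul hy.le, Real.one_rpow, mul_one, mul_one_div_cancel hp₀.ne', Real.rpow_one,
      mul_right_comm, ← Real.rpow_add hx, show q * (1 / p) + -q / p = 0 by ring, Real.rpow_zero,
      one_mul]
  rw [e] at h
  have h' := mul_le_mul_of_nonneg_left h hp₀.le
  have e' : p * (1 / p * (x ^ q * y ^ p) + -q / p * x + (p + q - 1) / p * 1) =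
      x ^ q * y ^ p - q * x + (p + q - 1) := by
    field_simp
    ring
  linarith

theorem rpow_mul_rpow_tangent_of_nonpos {p q : ℝ} (hp : p ≤ 0) (hq : q ≤ 0)
    {x y : ℝ} (hx : 0 < x) (hy : 0 < y) :
    q * x + p * y + (1 - p - q) ≤ x ^ q * y ^ p := by
  have hr : 0 < 1 - p - q := by linarith
  obtain ⟨r, hrdef⟩ : ∃ r, r = 1 - p - q := ⟨_, rfl⟩
  rw [← hrdef] at hr ⊢
  have h := Real.geom_mean_le_arith_mean3_weighted (w₁ := 1 / r) (w₂ := -q / r)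
    (w₃ := -p / r) (p₁ := x ^ q * y ^ p) (p₂ := x) (p₃ := y) (by positivity)
    (div_nonneg (by linarith) hr.le) (div_nonneg (by linarith) hr.le) (by positivity) hx.le
    hy.le (by field_simp; linarith)
  have e : (x ^ q * y ^ p) ^ (1 / r) * x ^ (-q / r) * y ^ (-p / r) = 1 := by
    rw [Real.mul_rpow (by positivity) (by positivity), ← Real.rpow_mul hx.le,
      ← Real.rpow_mul hy.le, mul_right_comm (x ^ _) (y ^ _) (x ^ _),
      ← Real.rpow_add hx,
      show q * (1 / r) + -q / r = 0 by ring, Real.rpow_zero, one_mul, ← Real.rpow_add hy,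
      show p * (1 / r) + -p / r = 0 by ring, Real.rpow_zero]
  rw [e] at h
  have h' := mul_le_mul_of_nonneg_left h hr.le
  have e' : r * (1 / r * (x ^ q * y ^ p) + -q / r * x + -p / r * y) =
      x ^ q * y ^ p - q * x - p * y := by
    field_simp
    ring
  linarith

/-- Convexity fails between `(1, ε)` and `(ε, 1)` when both exponents are positive. -/
theorem not_jensen_rpow_mul_rpow_of_pos {p q : ℝ} (hp : 0 < p) (hq : 0 < q) :
    ¬ ∀ a₁ a₂ b₁ b₂ : ℝ, 0 < a₁ → 0 < a₂ → 0 < b₁ → 0 < b₂ →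
      ∀ t : ℝ, 0 ≤ t → t ≤ 1 →
        (t * a₁ + (1 - t) * a₂) ^ q * (t * b₁ + (1 - t) * b₂) ^ p ≤
          t * (a₁ ^ q * b₁ ^ p) + (1 - t) * (a₂ ^ q * b₂ ^ p) := by
  intro h
  obtain ⟨R, hR, hlt⟩ := exists_rpow_neg_add_rpow_neg_lt hp hq
    (show (0 : ℝ) < (1 / 2) ^ q * (1 / 2) ^ p by positivity)
  have hR₀ : 0 < R := by linarith
  have hi : 0 < R⁻¹ := inv_pos.2 hR₀
  have hj := h 1 R⁻¹ R⁻¹ 1 one_pos hi hi one_pos (1 / 2) (by norm_num) (by norm_num)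
  rw [Real.inv_rpow hR₀.le, Real.inv_rpow hR₀.le, ← Real.rpow_neg hR₀.le,
    ← Real.rpow_neg hR₀.le, Real.one_rpow, Real.one_rpow] at hj
  have hl : (1 / 2 : ℝ) ^ q * (1 / 2) ^ p ≤ (1 / 2 * 1 + (1 - 1 / 2) * R⁻¹) ^ q *
      (1 / 2 * R⁻¹ + (1 - 1 / 2) * 1) ^ p := by
    gcongr <;> linarith
  have := Real.rpow_pos_of_pos hR₀ (-p)
  have := Real.rpow_pos_of_pos hR₀ (-q)
  linarith

/-- Convexity fails between `(R, R)` and `(1, R⁻¹)` when the degree is less than `1`. -/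
theorem one_le_add_of_jensen_rpow_mul_rpow {p q : ℝ} (hp : 0 < p) (hq : q ≤ 0)
    (h : ∀ a₁ a₂ b₁ b₂ : ℝ, 0 < a₁ → 0 < a₂ → 0 < b₁ → 0 < b₂ →
      ∀ t : ℝ, 0 ≤ t → t ≤ 1 →
        (t * a₁ + (1 - t) * a₂) ^ q * (t * b₁ + (1 - t) * b₂) ^ p ≤
          t * (a₁ ^ q * b₁ ^ p) + (1 - t) * (a₂ ^ q * b₂ ^ p)) :
    1 ≤ p + q := by
  by_contra! hpq
  obtain ⟨R, hR, hlt⟩ := exists_rpow_neg_add_rpow_neg_lt (sub_pos.2 hpq) hp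
    (show (0 : ℝ) < 2 ^ q by positivity)
  have hR₀ : 0 < R := by linarith
  have hi : 0 < R⁻¹ := inv_pos.2 hR₀
  have hi₁ : R⁻¹ ≤ 1 := inv_le_one_of_one_le₀ hR.le
  have hj := h R 1 R R⁻¹ hR₀ one_pos hR₀ hi R⁻¹ hi.le hi₁
  have e : R⁻¹ * (R ^ q * R ^ p) = R ^ (-(1 - (p + q))) := by
    rw [← Real.rpow_neg_one, ← Real.rpow_add hR₀, ← Real.rpow_add hR₀]
    congr 1
    ring
  rw [e, Real.one_rpow, one_mul, inv_mul_cancel₀ hR₀.ne', Real.inv_rpow hR₀.le,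
    ← Real.rpow_neg hR₀.le] at hj
  have h₁ : (2 : ℝ) ^ q ≤ (1 + (1 - R⁻¹) * 1) ^ q :=
    Real.rpow_le_rpow_of_nonpos (by linarith) (by linarith) hq
  have h₂ : (1 : ℝ) ≤ (1 + (1 - R⁻¹) * R⁻¹) ^ p :=
    Real.one_le_rpow (by nlinarith) hp.le
  have h₃ := le_mul_of_one_le_right (le_trans (by positivity) h₁) h₂
  have h₄ := mul_pos hi (Real.rpow_pos_of_pos hR₀ (-p))
  linarith

/-- The scalar function `(a,b) ↦ a^q b^p` is jointly convex on `(0,∞) × (0,∞)` if and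
only if (i) `p ≥ 1`, `q ≤ 0`, `p + q ≥ 1`, or (ii) `q ≥ 1`, `p ≤ 0`, `p + q ≥ 1`, or
(iii) `p ≤ 0` and `q ≤ 0`. -/
theorem scalar_power_jointly_convex_iff (p q : ℝ) :
    (∀ a₁ a₂ b₁ b₂ : ℝ, 0 < a₁ → 0 < a₂ → 0 < b₁ → 0 < b₂ →
      ∀ t : ℝ, 0 ≤ t → t ≤ 1 →
        (t * a₁ + (1 - t) * a₂) ^ q * (t * b₁ + (1 - t) * b₂) ^ p ≤
          t * (a₁ ^ q * b₁ ^ p) + (1 - t) * (a₂ ^ q * b₂ ^ p)) ↔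
      ((1 ≤ p ∧ q ≤ 0 ∧ 1 ≤ p + q) ∨ (1 ≤ q ∧ p ≤ 0 ∧ 1 ≤ p + q) ∨
        (p ≤ 0 ∧ q ≤ 0)) := by
  constructor
  · intro h
    have h' : ∀ a₁ a₂ b₁ b₂ : ℝ, 0 < a₁ → 0 < a₂ → 0 < b₁ → 0 < b₂ →
        ∀ t : ℝ, 0 ≤ t → t ≤ 1 →
          (t * a₁ + (1 - t) * a₂) ^ p * (t * b₁ + (1 - t) * b₂) ^ q ≤
            t * (a₁ ^ p * b₁ ^ q) + (1 - t) * (a₂ ^ p * b₂ ^ q) := by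
      intro a₁ a₂ b₁ b₂ ha₁ ha₂ hb₁ hb₂ t ht₀ ht₁
      simpa only [mul_comm (_ ^ q) (_ ^ p)] using h b₁ b₂ a₁ a₂ hb₁ hb₂ ha₁ ha₂ t ht₀ ht₁
    rcases le_or_gt p 0 with hp | hp <;> rcases le_or_gt q 0 with hq | hq
    · exact .inr (.inr ⟨hp, hq⟩)
    · have := one_le_add_of_jensen_rpow_mul_rpow hq hp h'
      exact .inr (.inl ⟨by linarith, hp, by linarith⟩)
    · have := one_le_add_of_jensen_rpow_mul_rpow hp hq h
      exact .inl ⟨by linarith, hq, this⟩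
    · exact (not_jensen_rpow_mul_rpow_of_pos hp hq h).elim
  · intro h a₁ a₂ b₁ b₂ ha₁ ha₂ hb₁ hb₂ t ht₀ ht₁
    refine rpow_mul_rpow_jensen_of_tangent (fun x y hx hy => ?_) ha₁ ha₂ hb₁ hb₂ ht₀ ht₁
    rcases h with ⟨hp, hq, hpq⟩ | ⟨hq, hp, hpq⟩ | ⟨hp, hq⟩
    · exact rpow_mul_rpow_tangent_of_one_le hp hq hpq hx hy
    · have := rpow_mul_rpow_tangent_of_one_le hq hp (by linarith) hy hx
      rw [mul_comm (x ^ q)]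
      linarith
    · exact rpow_mul_rpow_tangent_of_nonpos hp hq hx hy
end
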